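/- arXiv:2303.09309 — 3 statements merged into one kernel-verified Lean document; each statement's English description precedes it below -/
import Mathlib

section
/- Let A be an n×n real positive definite matrix (symmetric with positive eigenvalues) and let T be the 2n×2n block matrix T = fromBlocks A 0 0 A. Then there exist a 2n×2n real matrix L and an n×n real diagonal matrix D with positive diagonal entries such that L is symplectic (Lᵀ * J * L = J) and orthogonal (Lᵀ * L = 1), T = Lᵀ * (fromBlocks D 0 0 D) * L, and spectrum ℝ D = spectrum ℝ A. In particular the symplectic eigenvalues of T are exactly the eigenvalues of A. -/
open Matrix

/-- **Finite-dimensional Williamson form for `fromBlocks A 0 0 A`.**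
If `A` is an `n × n` real positive definite matrix and
`T = fromBlocks A 0 0 A`, then there is a matrix `L` which is symplectic
(`Lᵀ * J * L = J` with `J = fromBlocks 0 1 (-1) 0`) and orthogonal
(`Lᵀ * L = 1`), and a diagonal matrix `diagonal d` with positive entries, such
that `T = Lᵀ * (fromBlocks (diagonal d) 0 0 (diagonal d)) * L` and the spectrum
of `diagonal d` equals the spectrum of `A`. -/
theorem williamson_block_diag_same (n : ℕ) (A : Matrix (Fin n) (Fin n) ℝ)
    (hA : A.PosDef) :
    ∃ (L : Matrix (Fin n ⊕ Fin n) (Fin n ⊕ Fin n) ℝ) (d : Fin n → ℝ),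
      (∀ i, 0 < d i) ∧
      Lᵀ * Matrix.fromBlocks 0 1 (-1) 0 * L = Matrix.fromBlocks 0 1 (-1) 0 ∧
      Lᵀ * L = 1 ∧
      Matrix.fromBlocks A 0 0 A =
        Lᵀ * Matrix.fromBlocks (Matrix.diagonal d) 0 0 (Matrix.diagonal d) * L ∧
      spectrum ℝ (Matrix.diagonal d) = spectrum ℝ A := by
  let U : Matrix (Fin n) (Fin n) ℝ := (hA.isHermitian.eigenvectorUnitary).1
  have hUU : U * Uᵀ = 1 := by
    simpa [U, star_eq_conjTranspose] using Unitary.coe_mul_star_self hA.isHermitian.eigenvectorUnitary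
  have hspec : A = U * diagonal hA.isHermitian.eigenvalues * Uᵀ := by
    have h := hA.isHermitian.spectral_theorem
    rw [Unitary.conjStarAlgAut_apply, star_eq_conjTranspose, conjTranspose_eq_transpose_of_trivial]
      at h
    exact h
  refine ⟨fromBlocks Uᵀ 0 0 Uᵀ, hA.isHermitian.eigenvalues, hA.eigenvalues_pos, ?_, ?_, ?_, ?_⟩
  · simp [fromBlocks_transpose, fromBlocks_multiply, hUU]
  · simp [fromBlocks_transpose, fromBlocks_multiply, hUU]
  · simp [fromBlocks_transpose, fromBlocks_multiply, ← hspec, -fromBlocks_diagonal]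
  · rw [spectrum_diagonal, hA.isHermitian.spectrum_real_eq_range_eigenvalues]
end

section
/- Let A and B be 2n×2n real positive definite matrices that are symplectically equivalent, i.e. there is a 2n×2n real matrix L with Lᵀ * J * L = J and A = Lᵀ * B * L. Then L is invertible, J * A = L⁻¹ * (J * B) * L (so the matrices J * A and J * B are similar), and consequently J * A and J * B have the same characteristic polynomial and the same spectrum; in particular A and B have the same symplectic spectrum. -/
open Matrix

/-- If positive definite `A, B` are symplectically equivalent via `L`
(`Lᵀ * J * L = J`, `A = Lᵀ * B * L`, with `J = fromBlocks 0 1 (-1) 0`), then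
`L` is invertible, `J * A = L⁻¹ * (J * B) * L`, and `J * A` and `J * B` have
the same characteristic polynomial and the same spectrum; in particular `A`
and `B` have the same symplectic spectrum. -/
theorem symplectically_equivalent_same_spectrum (n : ℕ)
    (A B L : Matrix (Fin n ⊕ Fin n) (Fin n ⊕ Fin n) ℝ)
    (hA : A.PosDef) (hB : B.PosDef)
    (hL : Lᵀ * Matrix.fromBlocks 0 1 (-1) 0 * L = Matrix.fromBlocks 0 1 (-1) 0)
    (hAB : A = Lᵀ * B * L) :
    IsUnit L ∧
    Matrix.fromBlocks 0 1 (-1) 0 * A =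
      L⁻¹ * (Matrix.fromBlocks 0 1 (-1) 0 * B) * L ∧
    (Matrix.fromBlocks 0 1 (-1) 0 * A).charpoly =
      (Matrix.fromBlocks 0 1 (-1) 0 * B).charpoly ∧
    spectrum ℝ (Matrix.fromBlocks 0 1 (-1) 0 * A) =
      spectrum ℝ (Matrix.fromBlocks 0 1 (-1) 0 * B) := by
  set J : Matrix (Fin n ⊕ Fin n) (Fin n ⊕ Fin n) ℝ := Matrix.fromBlocks 0 1 (-1) 0 with hJ
  have hJJ : J * J = -1 := by
    rw [hJ, Matrix.fromBlocks_multiply, ← Matrix.fromBlocks_one, Matrix.fromBlocks_neg]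
    simp
  have hleft : (-(J * Lᵀ * J)) * L = 1 := by
    rw [neg_mul, mul_assoc, mul_assoc, ← mul_assoc Lᵀ, hL, hJJ, neg_neg]
  have hinv : L⁻¹ = -(J * Lᵀ * J) := Matrix.inv_eq_left_inv hleft
  have hunit : IsUnit L := IsUnit.of_mul_eq_one_right _ hleft
  have hsim : J * A = L⁻¹ * (J * B) * L := by
    have hJL : L⁻¹ * J = J * Lᵀ := by
      rw [hinv, neg_mul, mul_assoc, hJJ, mul_neg, mul_one, neg_neg]
    rw [← mul_assoc L⁻¹, hJL, hAB]
    simp only [mul_assoc]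
  obtain ⟨u, rfl⟩ := hunit
  refine ⟨u.isUnit, hsim, ?_, ?_⟩
  · rw [hsim, Matrix.charpoly_units_conj']
  · rw [hsim, ← Matrix.coe_units_inv, spectrum.units_conjugate']
end

section
/- Let 𝒜 be a unital complex Banach algebra (a complete normed ring that is a normed algebra over ℂ, with 1 ≠ 0), and let x, y ∈ 𝒜 with x * y = y * x. Then spectrum ℂ (x + y) ⊆ spectrum ℂ x + spectrum ℂ y, where the right-hand side is the set of all sums λ + μ with λ ∈ spectrum ℂ x and μ ∈ spectrum ℂ y. -/
open Pointwise

/-- Centralizers are inverse-closed, so passing to a centralizer does not enlarge the spectrum. -/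
theorem Subalgebra.spectrum_centralizer_eq {R A : Type*} [CommRing R] [Ring A] [Algebra R A]
    (s : Set A) (a : Subalgebra.centralizer R s) :
    spectrum R a = spectrum R (a : A) := by
  refine Set.Subset.antisymm (fun r hr hu => hr ?_)
    (AlgHom.spectrum_apply_subset (Subalgebra.centralizer R s).val a)
  obtain ⟨u, hu⟩ := hu
  have hmem : (u : A) ∈ Subalgebra.centralizer R s :=
    hu ▸ (algebraMap R (Subalgebra.centralizer R s) r - a).2
  have hinv : (↑u⁻¹ : A) ∈ Subalgebra.centralizer R s := fun g hg =>
    ((show Commute g (u : A) from hmem g hg).units_inv_right).eq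
  refine ⟨⟨algebraMap R _ r - a, ⟨_, hinv⟩, Subtype.ext ?_, Subtype.ext ?_⟩, rfl⟩
  · change (algebraMap R A r - a) * (↑u⁻¹ : A) = 1
    rw [← hu, u.mul_inv]
  · change (↑u⁻¹ : A) * (algebraMap R A r - a) = 1
    rw [← hu, u.inv_mul]

/-- In a unital complex Banach algebra, the spectrum of a sum of commuting
elements is contained in the (pointwise) sum of the spectra. -/
theorem spectrum_add_subset_of_commute {𝒜 : Type*} [NormedRing 𝒜]
    [NormedAlgebra ℂ 𝒜] [CompleteSpace 𝒜] [Nontrivial 𝒜]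
    (x y : 𝒜) (hxy : x * y = y * x) :
    spectrum ℂ (x + y) ⊆ spectrum ℂ x + spectrum ℂ y := by
  let B : Subalgebra ℂ 𝒜 := Subalgebra.centralizer ℂ (Set.centralizer {x, y})
  have hcomm : ∀ a ∈ ({x, y} : Set 𝒜), ∀ b ∈ ({x, y} : Set 𝒜), a * b = b * a := by
    rintro a (rfl | rfl) b (rfl | rfl) <;> first | rfl | exact hxy | exact hxy.symm
  let _ : NormedCommRing B :=
    { (inferInstance : NormedRing B) with
      mul_comm := fun a b =>
        Subtype.ext (Set.centralizer_centralizer_comm_of_comm hcomm _ a.2 _ b.2) }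
  have hclosed : IsClosed (B : Set 𝒜) := Set.isClosed_centralizer _
  have : CompleteSpace B := hclosed.completeSpace_coe
  have hsub : ({x, y} : Set 𝒜) ⊆ B := Set.subset_centralizer_centralizer
  let x' : B := ⟨x, hsub (by simp)⟩
  let y' : B := ⟨y, hsub (by simp)⟩
  have hspec (b : B) : spectrum ℂ b = spectrum ℂ (b : 𝒜) :=
    Subalgebra.spectrum_centralizer_eq _ b
  intro z hz
  obtain ⟨f, rfl⟩ := WeakDual.CharacterSpace.mem_spectrum_iff_exists.mp
    ((hspec (x' + y')).symm ▸ hz : z ∈ spectrum ℂ (x' + y'))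
  exact ⟨f x', hspec x' ▸ AlgHom.apply_mem_spectrum f x',
    f y', hspec y' ▸ AlgHom.apply_mem_spectrum f y', (map_add f x' y').symm⟩
end
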